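/- For every real C > 0 and Lebesgue-almost every irrational α ∈ (0,1), there exist infinitely many m ∈ ℕ such that a_m(α) > C · Σ_{i=1}^{m−1} a_i(α). -/

import Mathlib

open MeasureTheory Filter Set

noncomputable def gaussMap (x : ℝ) : ℝ := Int.fract (1 / x)

/-- The `n`-th continued fraction partial quotient of `α` (for `n ≥ 1`). -/
noncomputable def cfA (α : ℝ) (n : ℕ) : ℕ := ⌊1 / (gaussMap^[n - 1] α)⌋₊

/-- Irrationals of the unit interval. -/
def goodSet : Set ℝ := {x | Irrational x} ∩ Ioo 0 1

/-- Cylinder sets. -/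
def cyl (n : ℕ) (w : ℕ → ℕ) : Set ℝ := {x | x ∈ goodSet ∧ ∀ i < n, cfA x (i + 1) = w i}

lemma gauss_good {x : ℝ} (hx : x ∈ goodSet) : gaussMap x ∈ goodSet := by
  obtain ⟨hi, h0, h1⟩ := hx
  have h : Irrational (gaussMap x) := by
    unfold gaussMap Int.fract
    have : Irrational (1 / x) := by
      rw [one_div]; exact hi.inv
    exact this.sub_intCast _
  refine ⟨h, ?_, Int.fract_lt_one _⟩
  exact lt_of_le_of_ne (Int.fract_nonneg _) (fun h' => h.ne_zero h'.symm)

lemma iter_good {x : ℝ} (hx : x ∈ goodSet) (n : ℕ) : gaussMap^[n] x ∈ goodSet := by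
  induction n with
  | zero => exact hx
  | succ n ih => rw [Function.iterate_succ_apply']; exact gauss_good ih

lemma step_good {y : ℝ} (hy : y ∈ goodSet) :
    1 ≤ ⌊1 / y⌋₊ ∧ y = 1 / ((⌊1 / y⌋₊ : ℝ) + gaussMap y) := by
  obtain ⟨hi, h0, h1⟩ := hy
  have h1y : 1 ≤ 1 / y := by rw [le_div_iff₀ h0]; linarith
  refine ⟨Nat.le_floor (by simpa using h1y), ?_⟩
  have : (⌊1 / y⌋₊ : ℝ) = ((⌊1 / y⌋ : ℤ) : ℝ) := natCast_floor_eq_intCast_floor (by linarith)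
  rw [this, gaussMap, Int.floor_add_fract]
  simp

lemma step_inv {t : ℝ} (ht : t ∈ goodSet) {a : ℕ} (ha : 1 ≤ a) :
    1 / ((a : ℝ) + t) ∈ goodSet ∧ ⌊1 / (1 / ((a : ℝ) + t))⌋₊ = a ∧
      gaussMap (1 / ((a : ℝ) + t)) = t := by
  obtain ⟨hi, h0, h1⟩ := ht
  have ha' : (1 : ℝ) ≤ a := by exact_mod_cast ha
  refine ⟨⟨?_, by positivity, ?_⟩, ?_, ?_⟩
  · show Irrational _
    rw [one_div]
    exact (hi.natCast_add a).inv
  · rw [div_lt_one (by positivity)]; linarith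
  · rw [one_div_one_div, Nat.floor_eq_iff (by positivity)]
    constructor <;> linarith
  · rw [gaussMap, one_div_one_div, Int.fract_natCast_add, Int.fract_eq_self]
    exact ⟨h0.le, h1⟩

lemma cfA_succ (x : ℝ) (n : ℕ) : cfA x (n + 1) = ⌊1 / (gaussMap^[n] x)⌋₊ := rfl

lemma cyl_repr (n : ℕ) (w : ℕ → ℕ) (hw : ∀ i < n, 1 ≤ w i) :
    ∃ p p' q q' : ℝ, 0 < q ∧ 0 ≤ q' ∧ q' ≤ q ∧
      (∀ t ∈ goodSet, (p + t * p') / (q + t * q') ∈ cyl n w ∧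
        gaussMap^[n] ((p + t * p') / (q + t * q')) = t) ∧
      ∀ x ∈ cyl n w, (p + gaussMap^[n] x * p') / (q + gaussMap^[n] x * q') = x := by
  induction n with
  | zero =>
    refine ⟨0, 1, 1, 0, by norm_num, by norm_num, by norm_num, ?_, ?_⟩
    · intro t ht
      simp [cyl, ht]
    · intro x _
      simp
  | succ n ih =>
    obtain ⟨p, p', q, q', hq, hq', hqq, h1, h2⟩ := ih (fun i hi => hw i (by omega))
    have ha : 1 ≤ w n := hw n (by omega)
    have ha' : (1 : ℝ) ≤ w n := by exact_mod_cast ha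
    have key : ∀ t : ℝ, 0 < t → (p * w n + p' + t * p) / (q * w n + q' + t * q) =
        (p + (1 / ((w n : ℝ) + t)) * p') / (q + (1 / ((w n : ℝ) + t)) * q') := by
      intro t ht
      have : 0 < (w n : ℝ) + t := by linarith
      have h3 : 0 < q * w n + q' + t * q := by positivity
      have h4 : 0 < q * ((w n : ℝ) + t) + q' := by positivity
      field_simp
      ring
    refine ⟨p * w n + p', p, q * w n + q', q, by positivity, hq.le, by nlinarith, ?_, ?_⟩
    · intro t ht
      obtain ⟨g1, g2, g3⟩ := step_inv ht ha
      obtain ⟨k1, k2⟩ := h1 _ g1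
      rw [key t ht.2.1]
      refine ⟨⟨k1.1, ?_⟩, ?_⟩
      · intro i hi
        rcases Nat.lt_succ_iff_lt_or_eq.mp hi with h | h
        · exact k1.2 i h
        · subst h
          rw [cfA_succ, k2, g2]
      · rw [Function.iterate_succ_apply', k2, g3]
    · intro x hx
      have hx' : x ∈ cyl n w := ⟨hx.1, fun i hi => hx.2 i (by omega)⟩
      have hg := iter_good hx.1 n
      have hwn := hx.2 n (by omega)
      obtain ⟨-, s2⟩ := step_good hg
      rw [cfA_succ] at hwn
      rw [hwn] at s2
      rw [Function.iterate_succ_apply', key _ (gauss_good hg).2.1, ← s2]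
      exact h2 x hx'

lemma measurable_gaussMap : Measurable gaussMap := by
  unfold gaussMap
  exact measurable_fract.comp (measurable_const.div measurable_id)

lemma measurable_iter (n : ℕ) : Measurable (gaussMap^[n]) := measurable_gaussMap.iterate n

lemma measurable_cfA (n : ℕ) : Measurable (fun x => cfA x n) := by
  unfold cfA
  exact Nat.measurable_floor.comp (measurable_const.div (measurable_iter _))

lemma measurableSet_goodSet : MeasurableSet goodSet := by
  refine MeasurableSet.inter ?_ measurableSet_Ioo
  have : {x : ℝ | Irrational x} = (Set.range ((↑) : ℚ → ℝ))ᶜ := rfl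
  rw [this]
  exact (Set.countable_range _).measurableSet.compl

lemma goodSet_ae : goodSet =ᵐ[volume] Ioo (0 : ℝ) 1 := by
  have h : ∀ᵐ x : ℝ ∂volume, Irrational x := by
    have : (volume (Set.range ((↑) : ℚ → ℝ))) = 0 := (Set.countable_range _).measure_zero _
    rw [ae_iff]
    convert this using 2
    ext x; simp [Irrational]
  filter_upwards [h] with x hx
  apply propext
  exact ⟨fun h => h.2, fun h => ⟨hx, h⟩⟩

lemma volume_goodSet : volume goodSet = 1 := by
  rw [measure_congr goodSet_ae]; simp

lemma cyl_dist (n : ℕ) (w : ℕ → ℕ) : ∃ c : ENNReal, ∀ A : Set ℝ, MeasurableSet A →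
    c * volume (A ∩ goodSet) ≤ 4 * volume (cyl n w ∩ gaussMap^[n] ⁻¹' A) ∧
    volume (cyl n w ∩ gaussMap^[n] ⁻¹' A) ≤ c * volume (A ∩ goodSet) := by
  by_cases hw : ∀ i < n, 1 ≤ w i
  swap
  · refine ⟨0, fun A _ => ?_⟩
    have : cyl n w = ∅ := by
      push Not at hw
      obtain ⟨i, hi, hwi⟩ := hw
      ext x
      simp only [mem_empty_iff_false, iff_false]
      intro hx
      have h1 := hx.2 i hi
      have h2 := (step_good (iter_good hx.1 i)).1
      rw [cfA_succ] at h1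
      omega
    simp [this]
  obtain ⟨p, p', q, q', hq, hq', hqq, h1, h2⟩ := cyl_repr n w hw
  set D := p' * q - p * q' with hD
  refine ⟨ENNReal.ofReal (|D| / q ^ 2), fun A hA => ?_⟩
  set f : ℝ → ℝ := fun t => (p + t * p') / (q + t * q') with hf
  have hAm : MeasurableSet (A ∩ goodSet) := hA.inter measurableSet_goodSet
  have him : cyl n w ∩ gaussMap^[n] ⁻¹' A = f '' (A ∩ goodSet) := by
    ext x
    constructor
    · rintro ⟨hx, hxA⟩
      exact ⟨gaussMap^[n] x, ⟨hxA, iter_good hx.1 n⟩, h2 x hx⟩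
    · rintro ⟨t, ⟨htA, htg⟩, rfl⟩
      obtain ⟨k1, k2⟩ := h1 t htg
      refine ⟨k1, ?_⟩
      show gaussMap^[n] _ ∈ A
      simp only [hf]
      rw [k2]; exact htA
  have hder : ∀ t ∈ A ∩ goodSet, HasDerivWithinAt f (D / (q + t * q') ^ 2) (A ∩ goodSet) t := by
    intro t ht
    have ht0 := ht.2.2.1
    have hne : q + t * q' ≠ 0 := by positivity
    have e1 : HasDerivAt (fun t : ℝ => p + t * p') p' t := by
      simpa using ((hasDerivAt_id t).mul_const p').const_add p
    have e2 : HasDerivAt (fun t : ℝ => q + t * q') q' t := by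
      simpa using ((hasDerivAt_id t).mul_const q').const_add q
    have := (e1.div e2 hne).hasDerivWithinAt (s := A ∩ goodSet)
    refine this.congr_deriv ?_
    rw [hD]; congr 1; ring
  have hinj : InjOn f (A ∩ goodSet) := by
    intro s hs t ht hst
    rw [← (h1 s hs.2).2, ← (h1 t ht.2).2]
    exact congrArg _ hst
  have hvol : volume (f '' (A ∩ goodSet)) =
      ∫⁻ t in A ∩ goodSet, ENNReal.ofReal |D / (q + t * q') ^ 2| :=
    (lintegral_abs_det_fderiv_eq_addHaar_image volume hAm
      (fun t ht => (hder t ht).hasFDerivWithinAt) hinj).symm.trans (by simp)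
  rw [him, hvol]
  constructor
  · rw [← lintegral_const_mul' _ _ (by norm_num), ← setLIntegral_const]
    refine setLIntegral_mono' hAm fun t ht => ?_
    have ht0 := ht.2.2.1
    have ht1 := ht.2.2.2
    have : (4 : ENNReal) = ENNReal.ofReal 4 := by norm_num
    rw [this, ← ENNReal.ofReal_mul (by norm_num)]
    apply ENNReal.ofReal_le_ofReal
    have hpos : 0 < q + t * q' := by positivity
    rw [abs_div, abs_of_pos (pow_pos hpos 2), mul_div_assoc', div_le_div_iff₀ (by positivity) (by positivity)]
    have : (q + t * q') ^ 2 ≤ 4 * q ^ 2 := by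
      have : q + t * q' ≤ 2 * q := by nlinarith
      nlinarith
    nlinarith [abs_nonneg D]
  · rw [← setLIntegral_const]
    refine setLIntegral_mono' hAm fun t ht => ?_
    have ht0 := ht.2.2.1
    apply ENNReal.ofReal_le_ofReal
    have hpos : 0 < q + t * q' := by positivity
    rw [abs_div, abs_of_pos (pow_pos hpos 2)]
    gcongr
    nlinarith

/-- Bounded distortion, with constant 4. -/
lemma cyl_bounds (n : ℕ) (w : ℕ → ℕ) (A : Set ℝ) (hA : MeasurableSet A) :
    volume (cyl n w) * volume (A ∩ goodSet) ≤ 4 * volume (cyl n w ∩ gaussMap^[n] ⁻¹' A) ∧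
    volume (cyl n w ∩ gaussMap^[n] ⁻¹' A) ≤ 4 * volume (cyl n w) * volume (A ∩ goodSet) := by
  obtain ⟨c, hc⟩ := cyl_dist n w
  have hu := hc univ MeasurableSet.univ
  simp only [preimage_univ, inter_univ, univ_inter, volume_goodSet, mul_one] at hu
  obtain ⟨a1, a2⟩ := hc A hA
  exact ⟨(mul_le_mul_left hu.2 _).trans a1, a2.trans (mul_le_mul_left hu.1 _)⟩

/-- Lebesgue measure on the irrationals of the unit interval. -/
noncomputable def gm : Measure ℝ := volume.restrict goodSet

instance gm_prob : IsProbabilityMeasure gm := ⟨by simp [gm, volume_goodSet]⟩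

/-- The first `n` partial quotients. -/
noncomputable def vec (n : ℕ) (x : ℝ) : Fin n → ℕ := fun i => cfA x (i + 1)

lemma measurable_vec (n : ℕ) : Measurable (vec n) :=
  measurable_pi_lambda _ fun i => measurable_cfA _

/-- Extension by zero. -/
def extv {n : ℕ} (v : Fin n → ℕ) (i : ℕ) : ℕ := if h : i < n then v ⟨i, h⟩ else 0

lemma vec_cyl {n : ℕ} (v : Fin n → ℕ) : vec n ⁻¹' {v} ∩ goodSet = cyl n (extv v) := by
  ext x
  simp only [mem_inter_iff, mem_preimage, mem_singleton_iff, cyl, mem_setOf_eq]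
  constructor
  · rintro ⟨h, hx⟩
    refine ⟨hx, fun i hi => ?_⟩
    simp [extv, hi, ← h, vec]
  · rintro ⟨hx, h⟩
    refine ⟨?_, hx⟩
    funext i
    have := h i i.2
    simpa [extv, vec] using this

lemma gm_apply (A : Set ℝ) : gm A = volume (A ∩ goodSet) :=
  Measure.restrict_apply' measurableSet_goodSet

lemma gm_eq : gm = volume.restrict (Ioo (0 : ℝ) 1) := Measure.restrict_congr_set goodSet_ae

lemma vec_bounds {n : ℕ} (v : Fin n → ℕ) (A : Set ℝ) (hA : MeasurableSet A) :
    gm (vec n ⁻¹' {v}) * gm A ≤ 4 * gm (vec n ⁻¹' {v} ∩ gaussMap^[n] ⁻¹' A) ∧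
    gm (vec n ⁻¹' {v} ∩ gaussMap^[n] ⁻¹' A) ≤ 4 * gm (vec n ⁻¹' {v}) * gm A := by
  have := cyl_bounds n (extv v) A hA
  rw [← vec_cyl, inter_right_comm] at this
  simpa only [← gm_apply] using this

lemma vec_sum (n : ℕ) (E : Set ℝ) (V : Set (Fin n → ℕ)) :
    ∑' v : V, gm (vec n ⁻¹' {v.1} ∩ E) = gm (vec n ⁻¹' V ∩ E) := by
  have hm : ∀ V : Set (Fin n → ℕ), MeasurableSet (vec n ⁻¹' V) := fun V =>
    measurable_vec n (V.to_countable.measurableSet)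
  have := tsum_measure_preimage_singleton (μ := gm.restrict E) (V.to_countable) (f := vec n)
    (fun y _ => hm {y})
  rw [Measure.restrict_apply (hm V)] at this
  rw [← this]
  refine tsum_congr fun v => ?_
  rw [Measure.restrict_apply (hm _)]

lemma gm_iter_le (n : ℕ) (A : Set ℝ) (hA : MeasurableSet A) :
    gm (gaussMap^[n] ⁻¹' A) ≤ 4 * gm A := by
  have h1 := vec_sum n (gaussMap^[n] ⁻¹' A) univ
  have h2 := vec_sum n univ univ
  simp only [preimage_univ, univ_inter, inter_univ, measure_univ] at h1 h2
  rw [← h1]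
  calc _ ≤ ∑' v : (univ : Set (Fin n → ℕ)), 4 * gm (vec n ⁻¹' {v.1}) * gm A :=
        ENNReal.tsum_le_tsum fun v => (vec_bounds v.1 A hA).2
    _ = 4 * gm A := by
        rw [ENNReal.tsum_mul_right, ENNReal.tsum_mul_left, h2, mul_one]

/-- Partial sums of partial quotients. -/
noncomputable def psum (k : ℕ) (x : ℝ) : ℝ := ∑ i ∈ Finset.range k, (cfA x (i + 1) : ℝ)

lemma psum_vec (k : ℕ) (x : ℝ) : psum k x = ∑ i : Fin k, (vec k x i : ℝ) := by
  rw [psum, Finset.sum_range]; rfl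

lemma psum_nonneg (k : ℕ) (x : ℝ) : 0 ≤ psum k x := Finset.sum_nonneg fun _ _ => by positivity

lemma measurable_psum (k : ℕ) : Measurable (psum k) := by
  unfold psum
  refine Finset.measurable_sum _ fun i _ => ?_
  exact measurable_from_nat.comp (measurable_cfA (i + 1))

/-- The success event. -/
def evt (C : ℝ) (n : ℕ) : Set ℝ := {x | C * psum (n - 1) x < cfA x n}

/-- Lower bound for the conditional probability, as a function of the word. -/
noncomputable def lowb (C : ℝ) {k : ℕ} (v : Fin k → ℕ) : ℝ :=
  (1 / 4) * (1 / (C * ∑ i, (v i : ℝ) + 1))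

lemma lowb_nonneg {C : ℝ} (hC : 0 < C) {k : ℕ} (v : Fin k → ℕ) : 0 ≤ lowb C v := by
  unfold lowb
  positivity

lemma lowb_le {C : ℝ} (hC : 0 < C) {k : ℕ} (v : Fin k → ℕ) : lowb C v ≤ 1 := by
  unfold lowb
  have h : 0 ≤ C * ∑ i, (v i : ℝ) := by positivity
  have : 1 / (C * ∑ i, (v i : ℝ) + 1) ≤ 1 := by
    rw [div_le_one (by linarith)]; linarith
  linarith

lemma cond_single {C : ℝ} (hC : 0 < C) {k : ℕ} (v : Fin k → ℕ) :
    ENNReal.ofReal (lowb C v) * gm (vec k ⁻¹' {v}) ≤ gm (vec k ⁻¹' {v} ∩ evt C (k + 1)) := by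
  set s : ℝ := 1 / (C * ∑ i, (v i : ℝ) + 1) with hs
  have h : 0 ≤ C * ∑ i, (v i : ℝ) := by positivity
  have hs0 : 0 < s := by positivity
  have hs1 : s ≤ 1 := by
    rw [hs, div_le_one (by linarith)]; linarith
  have hA : gm (Iio s) = ENNReal.ofReal s := by
    rw [gm_eq, Measure.restrict_apply measurableSet_Iio]
    have : Iio s ∩ Ioo (0 : ℝ) 1 = Ioo 0 s := by
      ext x; simp only [mem_inter_iff, mem_Iio, mem_Ioo]
      constructor
      · rintro ⟨a, b, c⟩; exact ⟨b, a⟩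
      · rintro ⟨a, b⟩; exact ⟨b, a, by linarith⟩
    rw [this]; simp
  have h1 := (vec_bounds v (Iio s) measurableSet_Iio).1
  have h2 : gm (vec k ⁻¹' {v} ∩ gaussMap^[k] ⁻¹' (Iio s)) ≤
      gm (vec k ⁻¹' {v} ∩ evt C (k + 1)) := by
    rw [gm_apply, gm_apply]
    refine measure_mono ?_
    rintro x ⟨⟨hv, ht⟩, hx⟩
    refine ⟨⟨hv, ?_⟩, hx⟩
    have hv' : vec k x = v := hv
    have ht' : gaussMap^[k] x < s := ht
    have hpos := (iter_good hx k).2.1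
    show C * psum k x < cfA x (k + 1)
    rw [psum_vec, hv', cfA_succ]
    have h3 : C * ∑ i, (v i : ℝ) + 1 < 1 / gaussMap^[k] x := by
      rw [hs, lt_div_iff₀ (by positivity)] at ht'
      rw [lt_div_iff₀ hpos]; linarith
    have := Nat.lt_floor_add_one (1 / gaussMap^[k] x)
    linarith
  have h4 : ENNReal.ofReal (lowb C v) = ENNReal.ofReal (1 / 4) * ENNReal.ofReal s := by
    rw [← ENNReal.ofReal_mul (by norm_num)]; rfl
  have h5 : ENNReal.ofReal (1 / 4) * 4 = 1 := by
    have : (4 : ENNReal) = ENNReal.ofReal 4 := by norm_num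
    rw [this, ← ENNReal.ofReal_mul (by norm_num)]; norm_num
  calc _ = ENNReal.ofReal (1 / 4) * (gm (vec k ⁻¹' {v}) * gm (Iio s)) := by
        rw [h4, hA]; ring
    _ ≤ ENNReal.ofReal (1 / 4) * (4 * gm (vec k ⁻¹' {v} ∩ gaussMap^[k] ⁻¹' (Iio s))) := by gcongr
    _ = gm (vec k ⁻¹' {v} ∩ gaussMap^[k] ⁻¹' (Iio s)) := by rw [← mul_assoc, h5, one_mul]
    _ ≤ _ := h2

lemma cond_set {C : ℝ} (hC : 0 < C) {k : ℕ} (V : Set (Fin k → ℕ)) :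
    ∫⁻ x in vec k ⁻¹' V, ENNReal.ofReal (lowb C (vec k x)) ∂gm ≤
      gm (vec k ⁻¹' V ∩ evt C (k + 1)) := by
  have hV : MeasurableSet V := V.to_countable.measurableSet
  have hg : Measurable (fun v : Fin k → ℕ => ENNReal.ofReal (lowb C v)) := measurable_of_countable _
  rw [← setLIntegral_map hV hg (measurable_vec k), lintegral_countable _ V.to_countable, ← vec_sum]
  refine ENNReal.tsum_le_tsum fun v => ?_
  rw [Measure.map_apply (measurable_vec k) (measurableSet_singleton _)]
  exact cond_single hC v.1

/-- The filtration generated by the partial quotients. -/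
noncomputable def filt : Filtration ℕ (inferInstance : MeasurableSpace ℝ) where
  seq n := MeasurableSpace.comap (vec n) inferInstance
  mono' := by
    intro m n hmn
    have : vec m = (fun v : Fin n → ℕ => fun i : Fin m => v (Fin.castLE hmn i)) ∘ vec n := rfl
    show MeasurableSpace.comap (vec m) _ ≤ MeasurableSpace.comap (vec n) _
    rw [this, ← MeasurableSpace.comap_comp]
    exact MeasurableSpace.comap_mono (measurable_of_countable _).comap_le
  le' n := (measurable_vec n).comap_le

lemma evt_meas (C : ℝ) (n : ℕ) : MeasurableSet (evt C n) :=
  measurableSet_lt ((measurable_psum _).const_mul C) (measurable_from_nat.comp (measurable_cfA n))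

lemma evt_filt (C : ℝ) (n : ℕ) : MeasurableSet[filt (n + 1)] (evt C (n + 1)) := by
  refine ⟨{v | C * ∑ i : Fin n, (v i.castSucc : ℝ) < v (Fin.last n)},
    (Set.to_countable _).measurableSet, ?_⟩
  ext x
  simp only [mem_preimage, mem_setOf_eq, evt]
  rw [show n + 1 - 1 = n from rfl, psum_vec]
  rfl

lemma condExp_lower {C : ℝ} (hC : 0 < C) (k : ℕ) :
    ∀ᵐ x ∂gm, lowb C (vec k x) ≤ (gm[(evt C (k + 1)).indicator (1 : ℝ → ℝ) | filt k]) x := by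
  have hm : filt k ≤ (inferInstance : MeasurableSpace ℝ) := filt.le k
  have hgm : Measurable[filt k] (fun x => lowb C (vec k x)) :=
    (measurable_of_countable (lowb C)).comp (comap_measurable (vec k))
  have hgi : Integrable (fun x => lowb C (vec k x)) gm := by
    refine Integrable.of_bound (hgm.mono hm le_rfl).aestronglyMeasurable 1 ?_
    filter_upwards with x
    rw [Real.norm_of_nonneg (lowb_nonneg hC _)]
    exact lowb_le hC _
  have hind : Integrable ((evt C (k + 1)).indicator (1 : ℝ → ℝ)) gm :=
    (integrable_const (1 : ℝ)).indicator (evt_meas C _)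
  refine ae_le_of_ae_le_trim (hm := hm) ?_
  refine ae_le_of_forall_setIntegral_le (hgi.trim hm hgm.stronglyMeasurable)
    (integrable_condExp.trim hm stronglyMeasurable_condExp) ?_
  intro s hs _
  rw [← setIntegral_trim hm hgm.stronglyMeasurable hs,
    ← setIntegral_trim hm stronglyMeasurable_condExp hs, setIntegral_condExp hm hind hs]
  obtain ⟨V, hV, rfl⟩ := hs
  rw [integral_indicator_one (evt_meas C _), integral_eq_lintegral_of_nonneg_ae
    (Eventually.of_forall fun x => lowb_nonneg hC _) hgi.1.restrict]
  rw [measureReal_def, Measure.restrict_apply (evt_meas C _), inter_comm]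
  exact ENNReal.toReal_mono (measure_ne_top _ _) (cond_set hC V)

lemma tail_le (i r : ℕ) :
    gm {x | r + 1 ≤ cfA x (i + 1)} ≤ ENNReal.ofReal (4 * (1 / ((r : ℝ) + 1))) := by
  have hr : (0 : ℝ) < (r : ℝ) + 1 := by positivity
  calc gm {x | r + 1 ≤ cfA x (i + 1)} ≤ gm (gaussMap^[i] ⁻¹' (Iic (1 / ((r : ℝ) + 1)))) := by
        rw [gm_apply, gm_apply]
        refine measure_mono ?_
        rintro x ⟨h, hx⟩
        refine ⟨?_, hx⟩
        have h' : r + 1 ≤ ⌊1 / (gaussMap^[i] x)⌋₊ := h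
        have hpos := (iter_good hx i).2.1
        show gaussMap^[i] x ≤ 1 / ((r : ℝ) + 1)
        have h1 : ((r + 1 : ℕ) : ℝ) ≤ 1 / (gaussMap^[i] x) :=
          (Nat.le_floor_iff (by positivity)).1 h'
        push_cast at h1
        rw [le_div_iff₀ hpos] at h1
        rw [le_div_iff₀ hr]
        linarith
    _ ≤ 4 * gm (Iic (1 / ((r : ℝ) + 1))) := gm_iter_le _ _ measurableSet_Iic
    _ ≤ 4 * ENNReal.ofReal (1 / ((r : ℝ) + 1)) := by
        gcongr
        rw [gm_eq, Measure.restrict_apply measurableSet_Iic]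
        calc _ ≤ volume (Ioc (0 : ℝ) (1 / ((r : ℝ) + 1))) :=
              measure_mono fun x hx => ⟨hx.2.1, hx.1⟩
          _ = _ := by simp
    _ = _ := by
        rw [ENNReal.ofReal_mul (by norm_num)]; norm_num

lemma trunc_le (i M : ℕ) :
    ∫⁻ x, ((min (cfA x (i + 1)) M : ℕ) : ENNReal) ∂gm ≤
      ENNReal.ofReal (4 * (1 + Real.log M)) := by
  have hmin : ∀ a : ℕ, ((min a M : ℕ) : ENNReal) =
      ∑ r ∈ Finset.range M, if r + 1 ≤ a then 1 else 0 := by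
    intro a
    rw [Finset.sum_boole]
    congr 1
    have : Finset.filter (fun r => r + 1 ≤ a) (Finset.range M) = Finset.range (min a M) := by
      ext r; simp; omega
    rw [this, Finset.card_range]
  have hms : ∀ r, MeasurableSet {x | r + 1 ≤ cfA x (i + 1)} := fun r =>
    measurableSet_le measurable_const (measurable_cfA _)
  have hfun : ∀ x, ((min (cfA x (i + 1)) M : ℕ) : ENNReal) =
      ∑ r ∈ Finset.range M, {x | r + 1 ≤ cfA x (i + 1)}.indicator 1 x := by
    intro x
    rw [hmin]
    refine Finset.sum_congr rfl fun r _ => ?_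
    simp [indicator]
  simp_rw [hfun]
  rw [lintegral_finsetSum _ fun r _ => measurable_one.indicator (hms r)]
  calc _ ≤ ∑ r ∈ Finset.range M, ENNReal.ofReal (4 * (1 / ((r : ℝ) + 1))) := by
        refine Finset.sum_le_sum fun r _ => ?_
        rw [lintegral_indicator_one (hms r)]
        exact tail_le i r
    _ = ENNReal.ofReal (∑ r ∈ Finset.range M, (4 * (1 / ((r : ℝ) + 1)))) :=
        (ENNReal.ofReal_sum_of_nonneg fun r _ => by positivity).symm
    _ ≤ _ := by
        apply ENNReal.ofReal_le_ofReal
        rw [← Finset.mul_sum]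
        have := harmonic_le_one_add_log M
        simp only [harmonic, Rat.cast_sum, Rat.cast_inv, Rat.cast_natCast] at this
        have h2 : ∑ r ∈ Finset.range M, (1 / ((r : ℝ) + 1)) =
            ∑ r ∈ Finset.range M, (((r + 1 : ℕ) : ℝ))⁻¹ := by
          refine Finset.sum_congr rfl fun r _ => ?_
          push_cast; rw [one_div]
        rw [h2]
        linarith

/-- The bad event at scale `2 ^ k`. -/
def bad (K : ℝ) (k : ℕ) : Set ℝ := {x | K * (k + 1) * 2 ^ k < psum (2 ^ k) x}

lemma bad_le {K : ℝ} (hK : 0 < K) (k : ℕ) :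
    gm (bad K k) ≤ ENNReal.ofReal (4 / 2 ^ k + 8 / K) := by
  set m : ℕ := 2 ^ k with hm
  set M : ℕ := 4 ^ k with hM
  have hMpos : 0 < M := by positivity
  set ε : ENNReal := ENNReal.ofReal (K * (k + 1) * 2 ^ k) with hε
  set f : ℝ → ENNReal := fun x => ∑ i ∈ Finset.range m, ((min (cfA x (i + 1)) M : ℕ) : ENNReal)
    with hf
  have hfm : ∀ i, Measurable (fun x => ((min (cfA x (i + 1)) M : ℕ) : ENNReal)) := fun i =>
    (measurable_from_nat (f := fun a : ℕ => ((min a M : ℕ) : ENNReal))).comp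
      (measurable_cfA (i + 1))
  have hsub : bad K k ⊆ (⋃ i ∈ Finset.range m, {x | M - 1 + 1 ≤ cfA x (i + 1)}) ∪ {x | ε ≤ f x} := by
    intro x hx
    by_cases h : ∃ i ∈ Finset.range m, M ≤ cfA x (i + 1)
    · left
      obtain ⟨i, hi, h⟩ := h
      simp only [mem_iUnion]
      refine ⟨i, hi, ?_⟩
      show M - 1 + 1 ≤ cfA x (i + 1)
      omega
    · right
      push Not at h
      have : f x = ENNReal.ofReal (psum m x) := by
        simp only [hf, psum]
        rw [ENNReal.ofReal_sum_of_nonneg fun r _ => by positivity]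
        refine Finset.sum_congr rfl fun i hi => ?_
        rw [min_eq_left (h i hi).le, ENNReal.ofReal_natCast]
      show ε ≤ f x
      rw [this]
      exact ENNReal.ofReal_le_ofReal (le_of_lt hx)
  have h1 : gm (⋃ i ∈ Finset.range m, {x | M - 1 + 1 ≤ cfA x (i + 1)}) ≤
      ENNReal.ofReal (4 / 2 ^ k) := by
    refine (measure_biUnion_finset_le _ _).trans ?_
    calc _ ≤ ∑ i ∈ Finset.range m, ENNReal.ofReal (4 * (1 / (((M - 1 : ℕ) : ℝ) + 1))) :=
          Finset.sum_le_sum fun i _ => tail_le i _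
      _ = ENNReal.ofReal (4 / 2 ^ k) := by
          rw [← ENNReal.ofReal_sum_of_nonneg fun r _ => by positivity]
          congr 1
          have : (((M - 1 : ℕ) : ℝ) + 1) = 2 ^ k * 2 ^ k := by
            have : M - 1 + 1 = 2 ^ k * 2 ^ k := by
              rw [← mul_pow]; norm_num; omega
            exact_mod_cast this
          rw [this, Finset.sum_const, Finset.card_range, hm]
          simp only [nsmul_eq_mul]
          push_cast
          field_simp
  have h2 : gm {x | ε ≤ f x} ≤ ENNReal.ofReal (8 / K) := by
    have hεpos : 0 < K * (k + 1) * 2 ^ k := by positivity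
    have hmark := mul_meas_ge_le_lintegral (μ := gm) (f := f)
      (Finset.measurable_sum _ fun i _ => hfm i) ε
    have hint : ∫⁻ x, f x ∂gm ≤ ENNReal.ofReal (2 ^ k * (8 * (k + 1))) := by
      simp only [hf]
      rw [lintegral_finsetSum _ fun i _ => hfm i]
      calc _ ≤ ∑ i ∈ Finset.range m, ENNReal.ofReal (8 * ((k : ℝ) + 1)) := by
            refine Finset.sum_le_sum fun i _ => (trunc_le i M).trans ?_
            apply ENNReal.ofReal_le_ofReal
            have hl : Real.log M = k * (2 * Real.log 2) := by
              rw [hM]; push_cast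
              rw [Real.log_pow, show (4 : ℝ) = 2 ^ 2 by norm_num, Real.log_pow]; push_cast; ring
            rw [hl]
            have := Real.log_two_lt_d9
            have hk : (0 : ℝ) ≤ k := by positivity
            nlinarith
        _ = _ := by
            rw [← ENNReal.ofReal_sum_of_nonneg fun r _ => by positivity]
            congr 1
            rw [Finset.sum_const, Finset.card_range, hm]
            simp
    have h3 : ENNReal.ofReal (2 ^ k * (8 * (k + 1))) = ε * ENNReal.ofReal (8 / K) := by
      rw [hε, ← ENNReal.ofReal_mul hεpos.le]
      congr 1
      field_simp
    have h4 := hmark.trans (hint.trans h3.le)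
    exact (ENNReal.mul_le_mul_iff_right (by simpa [hε] using hεpos) ENNReal.ofReal_ne_top).1 h4
  calc _ ≤ _ := measure_mono hsub
    _ ≤ _ := measure_union_le _ _
    _ ≤ _ := add_le_add h1 h2
    _ = _ := (ENNReal.ofReal_add (by positivity) (by positivity)).symm

/-- The terms of the divergent series. -/
noncomputable def term (C : ℝ) (k : ℕ) (x : ℝ) : ℝ := (1 / 4) * (1 / (C * psum k x + 1))

lemma term_nonneg {C : ℝ} (hC : 0 < C) (k : ℕ) (x : ℝ) : 0 ≤ term C k x := by
  have := psum_nonneg k x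
  unfold term
  positivity

lemma measurable_term (C : ℝ) (k : ℕ) : Measurable (term C k) := by
  unfold term
  exact (measurable_const.div (((measurable_psum k).const_mul C).add_const 1)).const_mul _

lemma tsum_top {C : ℝ} (hC : 0 < C) :
    ∀ᵐ x ∂gm, ∑' k : ℕ, ENNReal.ofReal (2 ^ k * term C (2 ^ k) x) = ⊤ := by
  set Y : ℕ → ℝ → ENNReal := fun k x => ENNReal.ofReal (2 ^ k * term C (2 ^ k) x) with hY
  have hYm : ∀ k, Measurable (Y k) := fun k =>
    ((measurable_term C (2 ^ k)).const_mul _).ennreal_ofReal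
  set G : ℕ → Set ℝ := fun R => {x | ∑' k, Y k x ≤ R} with hG
  have hGm : ∀ R, MeasurableSet (G R) := fun R =>
    measurableSet_le (Measurable.ennreal_tsum hYm) measurable_const
  have main : ∀ R, gm (G R) = 0 := by
    intro R
    by_contra hne
    set η : ℝ := (gm (G R)).toReal / 2 with hη
    have hηpos : 0 < η := by
      have := ENNReal.toReal_pos hne (measure_ne_top _ _)
      positivity
    have hGη : gm (G R) = ENNReal.ofReal (η + η) := by
      rw [hη, add_halves, ENNReal.ofReal_toReal (measure_ne_top _ _)]
    set K : ℝ := 16 / η with hK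
    have hKpos : 0 < K := by positivity
    have h8 : 8 / K = η / 2 := by rw [hK]; field_simp; norm_num
    obtain ⟨k0, hk0⟩ : ∃ k0 : ℕ, ∀ k ≥ k0, 4 / (2 : ℝ) ^ k ≤ η / 2 := by
      have : Tendsto (fun k : ℕ => 4 / (2 : ℝ) ^ k) atTop (nhds 0) :=
        (tendsto_pow_atTop_atTop_of_one_lt (by norm_num : (1 : ℝ) < 2)).const_div_atTop 4
      exact eventually_atTop.1 (this.eventually_le_const (by positivity))
    set c : ℝ := (1 / 4) * (1 / (C * K + 1)) with hc
    have hcpos : 0 < c := by positivity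
    have hterm : ∀ k ≥ k0, ENNReal.ofReal (c * η * (1 / ((k : ℝ) + 1))) ≤ ∫⁻ x in G R, Y k x ∂gm := by
      intro k hk
      have hb := bad_le hKpos k
      rw [h8] at hb
      have hb' : gm (bad K k) ≤ ENNReal.ofReal η :=
        hb.trans (ENNReal.ofReal_le_ofReal (by linarith [hk0 k hk]))
      have hd : ENNReal.ofReal η ≤ gm (G R \ bad K k) := by
        have h1 : gm (G R) - gm (bad K k) ≤ gm (G R \ bad K k) := le_measure_diff
        refine le_trans ?_ h1
        rw [hGη, ENNReal.ofReal_add hηpos.le hηpos.le]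
        refine ENNReal.le_sub_of_add_le_right (measure_ne_top _ _) ?_
        gcongr
      have hbm : MeasurableSet (bad K k) := measurableSet_lt measurable_const (measurable_psum _)
      calc _ = ENNReal.ofReal (c * (1 / ((k : ℝ) + 1))) * ENNReal.ofReal η := by
            rw [← ENNReal.ofReal_mul (by positivity)]; congr 1; ring
        _ ≤ ENNReal.ofReal (c * (1 / ((k : ℝ) + 1))) * gm (G R \ bad K k) := by gcongr
        _ = ∫⁻ x in G R \ bad K k, ENNReal.ofReal (c * (1 / ((k : ℝ) + 1))) ∂gm := by
            rw [setLIntegral_const]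
        _ ≤ ∫⁻ x in G R \ bad K k, Y k x ∂gm := by
            refine setLIntegral_mono' ((hGm R).diff hbm) fun x hx => ?_
            apply ENNReal.ofReal_le_ofReal
            have hx2 : psum (2 ^ k) x ≤ K * (k + 1) * 2 ^ k := not_lt.1 hx.2
            have hp := psum_nonneg (2 ^ k) x
            have h2k : (1 : ℝ) ≤ 2 ^ k := one_le_pow₀ (by norm_num)
            have hk1 : (1 : ℝ) ≤ (k : ℝ) + 1 := by
              have : (0 : ℝ) ≤ k := by positivity
              linarith
            have e : C * psum (2 ^ k) x + 1 ≤ 2 ^ k * ((C * K + 1) * (k + 1)) := by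
              have e1 : C * psum (2 ^ k) x ≤ C * (K * (k + 1) * 2 ^ k) := by gcongr
              have e2 : (1 : ℝ) ≤ 2 ^ k * (k + 1) := by nlinarith
              nlinarith
            have hpos : 0 < C * psum (2 ^ k) x + 1 := by positivity
            unfold term
            calc c * (1 / ((k : ℝ) + 1))
                = 2 ^ k * (1 / 4 * (1 / (2 ^ k * ((C * K + 1) * (k + 1))))) := by
                  rw [hc]; field_simp
              _ ≤ _ := by gcongr
        _ ≤ _ := lintegral_mono_set diff_subset
    have hup : ∫⁻ x in G R, ∑' k, Y k x ∂gm ≤ R := by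
      calc _ ≤ ∫⁻ x in G R, (R : ENNReal) ∂gm := setLIntegral_mono' (hGm R) fun x hx => hx
        _ = R * gm (G R) := setLIntegral_const _ _
        _ ≤ R * 1 := by gcongr; exact prob_le_one
        _ = R := mul_one _
    rw [lintegral_tsum fun k => (hYm k).aemeasurable] at hup
    have hlow : ∑' k : ℕ, ENNReal.ofReal (c * η * (1 / (((k + k0 : ℕ) : ℝ) + 1))) ≤ R := by
      calc _ ≤ ∑' k : ℕ, ∫⁻ x in G R, Y (k + k0) x ∂gm :=
            ENNReal.tsum_le_tsum fun k => hterm _ (by omega)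
        _ ≤ ∑' k : ℕ, ∫⁻ x in G R, Y k x ∂gm :=
            ENNReal.tsum_comp_le_tsum_of_injective (add_left_injective k0) _
        _ ≤ R := hup
    have hsum := ENNReal.summable_toReal (ne_top_of_le_ne_top (ENNReal.natCast_ne_top R) hlow)
    have hsum' : Summable fun k : ℕ => c * η * (1 / (((k + k0 : ℕ) : ℝ) + 1)) := by
      refine hsum.congr fun k => ?_
      rw [ENNReal.toReal_ofReal (by positivity)]
    rw [summable_mul_left_iff (by positivity)] at hsum'
    have h3 : Summable fun k : ℕ => 1 / (((k + (k0 + 1) : ℕ) : ℝ)) := by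
      refine hsum'.congr fun k => ?_
      push_cast; ring
    rw [summable_nat_add_iff (f := fun k : ℕ => 1 / (k : ℝ)) (k0 + 1)] at h3
    exact Real.not_summable_one_div_natCast h3
  rw [ae_iff]
  refine measure_mono_null ?_ (measure_iUnion_null main)
  intro x hx
  obtain ⟨R, hR⟩ := ENNReal.exists_nat_gt (show ∑' k, Y k x ≠ ⊤ from hx)
  exact mem_iUnion.2 ⟨R, hR.le⟩

lemma term_tendsto {C : ℝ} (hC : 0 < C) {x : ℝ}
    (hx : ∑' k : ℕ, ENNReal.ofReal (2 ^ k * term C (2 ^ k) x) = ⊤) :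
    Tendsto (fun n => ∑ k ∈ Finset.range n, term C k x) atTop atTop := by
  rw [← not_summable_iff_tendsto_nat_atTop_of_nonneg fun k => term_nonneg hC k x,
    ← summable_condensed_iff_of_nonneg fun k => term_nonneg hC k x]
  · intro h
    exact h.tsum_ofReal_ne_top hx
  · intro m n _ hmn
    have hp := psum_nonneg m x
    have : psum m x ≤ psum n x :=
      Finset.sum_le_sum_of_subset_of_nonneg (Finset.range_mono hmn) fun _ _ _ => by positivity
    unfold term
    gcongr

theorem stmt9 (C : ℝ) (hC : 0 < C) :
    ∀ᵐ α ∂(volume.restrict (Set.Ioo (0:ℝ) 1)), Irrational α →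
      {m : ℕ | 1 ≤ m ∧
        C * ∑ i ∈ Finset.Icc 1 (m - 1), (cfA α i : ℝ) < (cfA α m : ℝ)}.Infinite := by
  rw [← gm_eq]
  set s : ℕ → Set ℝ := fun n => if n = 0 then ∅ else evt C n with hs
  have hsm : ∀ n, MeasurableSet[filt n] (s n) := by
    intro n
    cases n with
    | zero => simp [hs]
    | succ n => simpa [hs] using evt_filt C n
  filter_upwards [ae_mem_limsup_atTop_iff gm hsm, tsum_top hC,
    ae_all_iff.2 (condExp_lower hC)] with x h1 h2 h3 _
  have h4 : x ∈ limsup s atTop := by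
    rw [h1]
    refine tendsto_atTop_mono (fun n => ?_) (term_tendsto hC h2)
    refine Finset.sum_le_sum fun k _ => ?_
    have := h3 k
    simp only [hs, Nat.add_eq_zero_iff, one_ne_zero, and_false, if_false]
    rw [term, psum_vec]
    exact this
  rw [mem_limsup_iff_frequently_mem] at h4
  rw [← Nat.frequently_atTop_iff_infinite]
  refine h4.mono fun n hn => ?_
  by_cases h0 : n = 0
  · simp [hs, h0] at hn
  · simp only [hs, h0, if_false] at hn
    refine ⟨by omega, ?_⟩
    have hn' : C * psum (n - 1) x < cfA x n := hn
    convert hn' using 2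
    rw [psum, Finset.range_eq_Ico, Finset.sum_Ico_add' (fun i => (cfA x i : ℝ)) 0 (n - 1) 1]
    refine Finset.sum_congr ?_ fun _ _ => rfl
    ext i; simp
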